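/- Let E be a real inner product space and L : E → ℝ differentiable, μ-strongly convex and with ρ-Lipschitz gradient, 0 < μ ≤ ρ, with global minimizer w*. Fix w ∈ E and e ∈ E, and let w⁺ = w − (1/ρ)(∇L(w) + e). Then L(w⁺) − L(w*) ≤ (1 − μ/ρ)(L(w) − L(w*)) + (1/(2ρ))‖e‖². -/

import Mathlib

open scoped RealInnerProductSpace

/-- The descent lemma: a function with `ρ`-Lipschitz gradient is bounded above by its quadratic
model. -/
theorem le_quadratic_of_lipschitz_gradient
    {E : Type*} [NormedAddCommGroup E] [InnerProductSpace ℝ E] [CompleteSpace E]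
    {L : E → ℝ} {g : E → E} {ρ : ℝ} (hdiff : ∀ x : E, HasGradientAt L (g x) x)
    (hlip : ∀ x y : E, ‖g x - g y‖ ≤ ρ * ‖x - y‖) (x d : E) :
    L (x + d) ≤ L x + ⟪g x, d⟫ + ρ / 2 * ‖d‖ ^ 2 := by
  have hderiv (t : ℝ) :
      HasDerivAt (fun s : ℝ => L (x + s • d) - s * ⟪g x, d⟫ - ρ / 2 * ‖d‖ ^ 2 * s ^ 2)
        (⟪g (x + t • d), d⟫ - ⟪g x, d⟫ - ρ * ‖d‖ ^ 2 * t) t := by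
    have hline : HasDerivAt (fun s : ℝ => x + s • d) d t := by
      simpa using ((hasDerivAt_id t).smul_const d).const_add x
    have hL : HasDerivAt (fun s : ℝ => L (x + s • d)) ⟪g (x + t • d), d⟫ t := by
      have hcomp := (hdiff (x + t • d)).hasFDerivAt.comp_hasDerivAt t hline
      rwa [InnerProductSpace.toDual_apply_apply] at hcomp
    refine ((hL.sub ((hasDerivAt_id t).mul_const ⟪g x, d⟫)).sub
      (((hasDerivAt_id t).pow 2).const_mul (ρ / 2 * ‖d‖ ^ 2))).congr_deriv ?_
    simp
    ring
  have hanti := antitoneOn_of_deriv_nonpos (convex_Icc (0 : ℝ) 1)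
    (fun t _ => (hderiv t).continuousAt.continuousWithinAt)
    (fun t _ => (hderiv t).differentiableAt.differentiableWithinAt)
    (fun t ht => by
      rw [interior_Icc] at ht
      rw [(hderiv t).deriv, ← inner_sub_left]
      have hg := hlip (x + t • d) x
      rw [add_sub_cancel_left, norm_smul, Real.norm_of_nonneg ht.1.le] at hg
      have hinner := real_inner_le_norm (g (x + t • d) - g x) d
      have hmul := mul_le_mul_of_nonneg_right hg (norm_nonneg d)
      linarith)
  have h := hanti (Set.left_mem_Icc.2 zero_le_one) (Set.right_mem_Icc.2 zero_le_one) zero_le_one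
  simp only [one_smul, zero_smul, add_zero] at h
  linarith

/-- The gradient lower bound given by `μ`-strong convexity between two points. -/
theorem two_mul_sub_le_norm_gradient_sq
    {E : Type*} [NormedAddCommGroup E] [InnerProductSpace ℝ E]
    {a b μ : ℝ} {v d : E} (hμ : 0 < μ) (h : a + ⟪d, v⟫ + μ / 2 * ‖d‖ ^ 2 ≤ b) :
    2 * μ * (a - b) ≤ ‖v‖ ^ 2 := by
  have hsq := norm_add_sq_real v (μ • d)
  rw [norm_smul, Real.norm_of_nonneg hμ.le, inner_smul_right, real_inner_comm] at hsq
  have hmul := mul_le_mul_of_nonneg_left h hμ.le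
  linarith [sq_nonneg ‖v + μ • d‖]

/-- A gradient step of size `1 / ρ`, with the gradient perturbed by `e`, decreases a function with
`ρ`-Lipschitz gradient up to the error `‖e‖ ^ 2 / (2 * ρ)`. -/
theorem perturbed_gradient_step_le
    {E : Type*} [NormedAddCommGroup E] [InnerProductSpace ℝ E] [CompleteSpace E]
    {L : E → ℝ} {g : E → E} {ρ : ℝ} (hρ : 0 < ρ) (hdiff : ∀ x : E, HasGradientAt L (g x) x)
    (hlip : ∀ x y : E, ‖g x - g y‖ ≤ ρ * ‖x - y‖) (w e : E) :
    L (w - (1 / ρ) • (g w + e)) ≤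
      L w - 1 / (2 * ρ) * ‖g w‖ ^ 2 + 1 / (2 * ρ) * ‖e‖ ^ 2 := by
  have h := le_quadratic_of_lipschitz_gradient hdiff hlip w (-((1 / ρ) • (g w + e)))
  rw [← sub_eq_add_neg, inner_neg_right, norm_neg, norm_smul, inner_smul_right, inner_add_right,
    real_inner_self_eq_norm_sq, Real.norm_of_nonneg (by positivity), mul_pow,
    norm_add_sq_real] at h
  refine h.trans_eq ?_
  field_simp
  ring

/-- Steps (a)+(b) of the USD-FL optimality-gap proof: one perturbed gradient step
with step size `1/ρ` contracts the optimality gap up to the perturbation term. -/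
theorem usd_fl_perturbed_contraction
    {E : Type*} [NormedAddCommGroup E] [InnerProductSpace ℝ E] [CompleteSpace E]
    (L : E → ℝ) (g : E → E) (μ ρ : ℝ) (hμ : 0 < μ) (hμρ : μ ≤ ρ)
    (hdiff : ∀ x : E, HasGradientAt L (g x) x)
    (hconv : ∀ w w' : E, L w' ≥ L w + ⟪w' - w, g w⟫ + μ / 2 * ‖w' - w‖ ^ 2)
    (hlip : ∀ w w' : E, ‖g w - g w'‖ ≤ ρ * ‖w - w'‖)
    (wstar : E) (hmin : ∀ w : E, L wstar ≤ L w)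
    (w e : E) :
    L (w - (1 / ρ) • (g w + e)) - L wstar ≤
      (1 - μ / ρ) * (L w - L wstar) + 1 / (2 * ρ) * ‖e‖ ^ 2 := by
  have hρ : 0 < ρ := hμ.trans_le hμρ
  have hstep := perturbed_gradient_step_le hρ hdiff hlip w e
  have hgrad := mul_le_mul_of_nonneg_left
    (two_mul_sub_le_norm_gradient_sq hμ (hconv w wstar)) (by positivity : 0 ≤ 1 / (2 * ρ))
  have hrate : 1 / (2 * ρ) * (2 * μ * (L w - L wstar)) = μ / ρ * (L w - L wstar) := by
    field_simp
  linarith
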